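/- arXiv:1110.3460 — 2 statements merged into one kernel-verified Lean document; each statement's English description precedes it below -/
import Mathlib

section
/- Under the stated fixed-dimension hypotheses, the identity δ̃ + αζ̃ = (1/(1 − γγ̃)) · (1/N)tr[T(I_N + δT)^{-2}] holds. (Lemma on auxiliary relations, first identity.) -/
open MeasureTheory ProbabilityTheory Matrix Filter

/-- The resolvent identity `X Q = a (X Q)² + b X Q²` for `Q = (a X + b)⁻¹`. -/
theorem trace_mul_resolvent {n : Type*} [Fintype n] [DecidableEq n] {X : Matrix n n ℝ}
    (hX : X.PosSemidef) {a b : ℝ} (ha : 0 ≤ a) (hb : 0 < b) :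
    (X * (a • X + b • 1)⁻¹).trace =
      a * ((X * (a • X + b • 1)⁻¹) ^ 2).trace + b * (X * (a • X + b • 1)⁻¹ ^ 2).trace := by
  have hpd : (a • X + b • (1 : Matrix n n ℝ)).PosDef :=
    Matrix.PosDef.posSemidef_add (hX.smul ha) (Matrix.PosDef.one.smul hb)
  have hinv : (a • X + b • (1 : Matrix n n ℝ)) * (a • X + b • 1)⁻¹ = 1 :=
    Matrix.mul_nonsing_inv _ ((Matrix.isUnit_iff_isUnit_det _).mp hpd.isUnit)
  generalize (a • X + b • (1 : Matrix n n ℝ))⁻¹ = Q at hinv ⊢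
  have key : X * Q = a • (X * Q) ^ 2 + b • (X * Q ^ 2) := by
    calc X * Q = X * Q * ((a • X + b • (1 : Matrix n n ℝ)) * Q) := by rw [hinv, mul_one]
      _ = a • (X * Q) ^ 2 + b • (X * Q ^ 2) := by
        simp only [add_mul, mul_add, smul_mul_assoc, mul_smul_comm, one_mul, pow_two, mul_assoc]
  simpa only [Matrix.trace_add, Matrix.trace_smul, smul_eq_mul] using congrArg Matrix.trace key

/-- **Lemma on auxiliary relations, first identity:**
`δ̃ + αζ̃ = (1/(1 − γγ̃)) · (1/N)tr[T(I + δT)⁻²]`. -/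
theorem stmt_9
    (M N : ℕ) (hM : 1 ≤ M) (hN : 1 ≤ N) (α : ℝ) (hα : 0 < α)
    (R : Matrix (Fin M) (Fin M) ℝ) (hR : R.PosSemidef)
    (t : Fin N → ℝ) (ht : ∀ n, 0 ≤ t n)
    (δt δ : ℝ) (hδt_pos : 0 < δt) (hδ_pos : 0 < δ)
    (hδt_eq : δt = ((N : ℝ))⁻¹ *
      (Matrix.diagonal t * (1 + δ • Matrix.diagonal t)⁻¹).trace)
    (hδ_eq : δ = ((N : ℝ))⁻¹ * (R * (δt • R + α • 1)⁻¹).trace)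
    (γ γt : ℝ)
    (hγ_eq : γ = ((N : ℝ))⁻¹ * ((R * (δt • R + α • 1)⁻¹) ^ 2).trace)
    (hγt_eq : γt = ((N : ℝ))⁻¹ *
      ((Matrix.diagonal t * (1 + δ • Matrix.diagonal t)⁻¹) ^ 2).trace)
    (hne : γ * γt ≠ 1)
    (ζ ζt : ℝ)
    (hζ_eq : ζ = (1 - γ * γt)⁻¹ *
      (((N : ℝ))⁻¹ * (R * ((δt • R + α • 1)⁻¹ ^ 2)).trace))
    (hζt_eq : ζt = -γt * ζ)
    :
    δt + α * ζt = (1 - γ * γt)⁻¹ *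
      (((N : ℝ))⁻¹ * (Matrix.diagonal t * ((1 + δ • Matrix.diagonal t)⁻¹ ^ 2)).trace) := by
  have h_R := trace_mul_resolvent hR hδt_pos.le hα
  have h_T := trace_mul_resolvent (Matrix.PosSemidef.diagonal ht) hδ_pos.le one_pos
  rw [one_smul, add_comm (δ • Matrix.diagonal t) 1, one_mul] at h_T
  rw [h_R] at hδ_eq
  rw [h_T] at hδt_eq
  have h_ne : 1 - γ * γt ≠ 0 := sub_ne_zero.mpr hne.symm
  rw [mul_add, mul_left_comm _ δt, ← hγ_eq, mul_left_comm _ α] at hδ_eq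
  rw [mul_add, mul_left_comm _ δ, ← hγt_eq] at hδt_eq
  rw [hζt_eq, hζ_eq]
  linear_combination (-δt) * mul_inv_cancel₀ h_ne +
    (1 - γ * γt)⁻¹ * (hδt_eq + γt * hδ_eq)
end

section
/- Under the stated fixed-dimension hypotheses, the identity δ − αζ = (γ/(1 − γγ̃)) · (1/N)tr[T(I_N + δT)^{-2}] holds. (Lemma on auxiliary relations, second identity.) -/
open MeasureTheory ProbabilityTheory Matrix Filter

/-- Trace form of the resolvent identity `A X⁻¹ = a (A X⁻¹)² + b A X⁻²` for `X = a A + b`. -/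
theorem trace_mul_inv_smul_add_smul_one {n : Type*} [Fintype n] [DecidableEq n]
    {K : Type*} [CommRing K] (A : Matrix n n K) (a b : K) (h : IsUnit (a • A + b • 1)) :
    (A * (a • A + b • 1)⁻¹).trace =
      a * ((A * (a • A + b • 1)⁻¹) ^ 2).trace + b * (A * (a • A + b • 1)⁻¹ ^ 2).trace := by
  have key : A * (a • A + b • 1)⁻¹ = A * (a • A + b • 1)⁻¹ * (a • A + b • 1) *
      (a • A + b • 1)⁻¹ := by
    rw [Matrix.mul_nonsing_inv_cancel_right _ _ ((Matrix.isUnit_iff_isUnit_det _).1 h)]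
  generalize (a • A + b • 1)⁻¹ = Q at key ⊢
  have expand : A * Q = a • (A * Q) ^ 2 + b • (A * Q ^ 2) := by
    refine key.trans ?_
    simp only [mul_add, add_mul, Matrix.mul_smul, Matrix.smul_mul, mul_one, pow_two,
      mul_assoc]
  conv_lhs => rw [expand]
  simp only [Matrix.trace_add, Matrix.trace_smul, smul_eq_mul]

/-- A positive multiple of the identity shifts a positive semidefinite matrix to a unit. -/
theorem Matrix.PosSemidef.isUnit_smul_add_smul_one {n : Type*} [Fintype n] [DecidableEq n]
    {A : Matrix n n ℝ} (hA : A.PosSemidef) {a b : ℝ} (ha : 0 ≤ a) (hb : 0 < b) :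
    IsUnit (a • A + b • 1) :=
  (Matrix.PosDef.posSemidef_add (hA.smul ha) (Matrix.PosDef.one.smul hb)).isUnit

/-- **Lemma on auxiliary relations, second identity:**
`δ − αζ = (γ/(1 − γγ̃)) · (1/N)tr[T(I + δT)⁻²]`. -/
theorem stmt_10
    (M N : ℕ) (hM : 1 ≤ M) (hN : 1 ≤ N) (α : ℝ) (hα : 0 < α)
    (R : Matrix (Fin M) (Fin M) ℝ) (hR : R.PosSemidef)
    (t : Fin N → ℝ) (ht : ∀ n, 0 ≤ t n)
    (δt δ : ℝ) (hδt_pos : 0 < δt) (hδ_pos : 0 < δ)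
    (hδt_eq : δt = ((N : ℝ))⁻¹ *
      (Matrix.diagonal t * (1 + δ • Matrix.diagonal t)⁻¹).trace)
    (hδ_eq : δ = ((N : ℝ))⁻¹ * (R * (δt • R + α • 1)⁻¹).trace)
    (γ γt : ℝ)
    (hγ_eq : γ = ((N : ℝ))⁻¹ * ((R * (δt • R + α • 1)⁻¹) ^ 2).trace)
    (hγt_eq : γt = ((N : ℝ))⁻¹ *
      ((Matrix.diagonal t * (1 + δ • Matrix.diagonal t)⁻¹) ^ 2).trace)
    (hne : γ * γt ≠ 1)
    (ζ ζt : ℝ)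
    (hζ_eq : ζ = (1 - γ * γt)⁻¹ *
      (((N : ℝ))⁻¹ * (R * ((δt • R + α • 1)⁻¹ ^ 2)).trace))
    (hζt_eq : ζt = -γt * ζ)
    :
    δ - α * ζ = γ / (1 - γ * γt) *
      (((N : ℝ))⁻¹ * (Matrix.diagonal t * ((1 + δ • Matrix.diagonal t)⁻¹ ^ 2)).trace) := by
  have hR_res := trace_mul_inv_smul_add_smul_one R δt α
    (hR.isUnit_smul_add_smul_one hδt_pos.le hα)
  have hT_res := trace_mul_inv_smul_add_smul_one (Matrix.diagonal t) δ 1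
    ((Matrix.PosSemidef.diagonal ht).isUnit_smul_add_smul_one hδ_pos.le one_pos)
  rw [one_smul, add_comm _ (1 : Matrix (Fin N) (Fin N) ℝ), one_mul] at hT_res
  rw [hR_res, mul_add, mul_left_comm, ← hγ_eq] at hδ_eq
  rw [hT_res, mul_add, mul_left_comm, ← hγt_eq] at hδt_eq
  have hne' : 1 - γ * γt ≠ 0 := sub_ne_zero.2 hne.symm
  rw [hζ_eq]
  generalize (Matrix.diagonal t * (1 + δ • Matrix.diagonal t)⁻¹ ^ 2).trace = p at *
  generalize (R * (δt • R + α • 1)⁻¹ ^ 2).trace = q at *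
  generalize (N : ℝ)⁻¹ = c at *
  clear hγ_eq hγt_eq hR_res hT_res
  field_simp
  linear_combination hδ_eq + γ * hδt_eq
end
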